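/- arXiv:2111.08117 — 3 statements merged into one kernel-verified Lean document; each statement's English description precedes it below -/
import Mathlib

section
/- Let f : ℝ^n → ℝ be a piecewise constant function with p ≥ 2 pieces. Then there exists a linear threshold neural network with 2 hidden layers and size at most p(p+1)/2 + 1 that computes a function g : ℝ^n → ℝ with g(x) = f(x) for Lebesgue-almost every x ∈ ℝ^n. -/
open Finset MeasureTheory

noncomputable section

/-- The threshold activation function. -/
def thresh (t : ℝ) : ℝ := if 0 < t then 1 else 0

/-- `T` is an affine map from `ℝ^a` to `ℝ^b`. -/
def IsAffineMap {a b : ℕ} (T : (Fin a → ℝ) → (Fin b → ℝ)) : Prop :=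
  ∃ (M : Fin b → Fin a → ℝ) (c : Fin b → ℝ),
    ∀ x j, T x j = (∑ i, M j i * x i) + c j

/-- `Hidden n k s w g` : `g = σ ∘ T_k ∘ ⋯ ∘ σ ∘ T_1 : ℝ^n → ℝ^w` is the function computed
by `k` hidden threshold layers, where the last hidden layer has width `w` and the total
number of hidden neurons (the size) is `s`. -/
inductive Hidden (n : ℕ) : ℕ → ℕ → (w : ℕ) → ((Fin n → ℝ) → (Fin w → ℝ)) → Prop
  | single {w : ℕ} (T : (Fin n → ℝ) → (Fin w → ℝ)) (hT : IsAffineMap T) :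
      Hidden n 1 w w (fun x j => thresh (T x j))
  | comp {k s w w' : ℕ} {g : (Fin n → ℝ) → (Fin w → ℝ)}
      (T : (Fin w → ℝ) → (Fin w' → ℝ)) (hg : Hidden n k s w g) (hT : IsAffineMap T) :
      Hidden n (k + 1) (s + w') w' (fun x j => thresh (T (g x) j))

/-- `f : ℝ^n → ℝ` is computed by a linear threshold neural network with `k` hidden layers
and size (number of hidden neurons) `s`. -/
def LTComputes (n k s : ℕ) (f : (Fin n → ℝ) → ℝ) : Prop :=
  ∃ (w : ℕ) (g : (Fin n → ℝ) → (Fin w → ℝ)) (a : Fin w → ℝ) (c : ℝ),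
    Hidden n k s w g ∧ ∀ x, f x = (∑ j, a j * g x j) + c

/-- A polyhedron in `ℝ^n`: the intersection of finitely many closed halfspaces. -/
def IsPolyhedron {n : ℕ} (P : Set (Fin n → ℝ)) : Prop :=
  ∃ (m : ℕ) (a : Fin m → Fin n → ℝ) (b : Fin m → ℝ),
    P = {x | ∀ i, (∑ j, a i j * x j) ≤ b i}

/-- `F` is a face of the polyhedron `P`. -/
def IsFace {n : ℕ} (F P : Set (Fin n → ℝ)) : Prop :=
  ∃ (c : Fin n → ℝ) (d : ℝ),
    (∀ x ∈ P, (∑ j, c j * x j) ≤ d) ∧ F = {x ∈ P | (∑ j, c j * x j) = d}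

/-- A (finite) polyhedral complex in `ℝ^n`. -/
def IsPolyhedralComplex {n : ℕ} (Pc : Finset (Set (Fin n → ℝ))) : Prop :=
  (∀ P ∈ Pc, IsPolyhedron P) ∧
  (∀ P ∈ Pc, ∀ Q ∈ Pc, IsFace (P ∩ Q) P ∧ IsFace (P ∩ Q) Q) ∧
  (∀ P ∈ Pc, ∀ F, IsFace F P → F ∈ Pc)

/-- The union of the members of `Pc` is all of `ℝ^n`. -/
def Covers {n : ℕ} (Pc : Finset (Set (Fin n → ℝ))) : Prop :=
  ⋃₀ (Pc : Set (Set (Fin n → ℝ))) = Set.univ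

/-- The dimension of a polyhedron: the dimension of its affine hull. -/
def polyDim {n : ℕ} (P : Set (Fin n → ℝ)) : ℕ :=
  Module.finrank ℝ (affineSpan ℝ P).direction

/-- `Pc` is a polyhedral complex covering `ℝ^n` with which `f` is compatible as a piecewise
constant function: `f` is constant on the relative interior of each member of `Pc`. -/
def CompatiblePWC {n : ℕ} (f : (Fin n → ℝ) → ℝ) (Pc : Finset (Set (Fin n → ℝ))) : Prop :=
  IsPolyhedralComplex Pc ∧ Covers Pc ∧
    ∀ P ∈ Pc, ∃ c : ℝ, ∀ x ∈ intrinsicInterior ℝ P, f x = c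

/-- `f : ℝ^n → ℝ` is piecewise constant. -/
def IsPWC {n : ℕ} (f : (Fin n → ℝ) → ℝ) : Prop := ∃ Pc, CompatiblePWC f Pc

/-- The cardinality `|Pc*_f|` of a minimum-cardinality polyhedral complex compatible with `f`. -/
def minCardPWC {n : ℕ} (f : (Fin n → ℝ) → ℝ) : ℕ :=
  sInf {c : ℕ | ∃ Pc, CompatiblePWC f Pc ∧ Pc.card = c}

lemma thresh_mem_Icc (t : ℝ) : 0 ≤ thresh t ∧ thresh t ≤ 1 := by
  unfold thresh
  split_ifs <;> norm_num

lemma IsPolyhedron.convex {n : ℕ} {P : Set (Fin n → ℝ)} (hP : IsPolyhedron P) :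
    Convex ℝ P := by
  obtain ⟨m, a, b, rfl⟩ := hP
  intro x hx y hy s t hs ht hst i
  have hx' : ∑ j, a i j * x j ≤ b i := hx i
  have hy' : ∑ j, a i j * y j ≤ b i := hy i
  have h : ∑ j, a i j * (s • x + t • y) j = s * ∑ j, a i j * x j + t * ∑ j, a i j * y j := by
    simp only [Finset.mul_sum, ← Finset.sum_add_distrib, Pi.add_apply, Pi.smul_apply, smul_eq_mul]
    exact Finset.sum_congr rfl fun j _ => by ring
  rw [h]
  calc s * ∑ j, a i j * x j + t * ∑ j, a i j * y j ≤ s * b i + t * b i := by gcongr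
    _ = b i := by rw [← add_mul, hst, one_mul]

/-- A face that contains an interior point is the whole set. -/
lemma IsFace.eq_of_mem_interior {n : ℕ} {F P : Set (Fin n → ℝ)} (hF : IsFace F P)
    {z : Fin n → ℝ} (hzF : z ∈ F) (hzP : z ∈ interior P) : F = P := by
  obtain ⟨c, d, hle, rfl⟩ := hF
  refine Set.Subset.antisymm (Set.sep_subset _ _) fun x hx => ⟨hx, ?_⟩
  have hcont : Filter.Tendsto (fun t : ℝ => z + t • (z - x)) (nhds 0) (nhds z) := by
    have : Continuous fun t : ℝ => z + t • (z - x) := by fun_prop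
    simpa using this.tendsto 0
  have hev := hcont.eventually (mem_interior_iff_mem_nhds.mp hzP)
  obtain ⟨t, htP, ht0⟩ :=
    ((hev.filter_mono nhdsWithin_le_nhds).and (self_mem_nhdsWithin (s := Set.Ioi (0 : ℝ)))).exists
  have h1 := hle _ htP
  have h2 : ∑ j, c j * (z + t • (z - x)) j
      = ∑ j, c j * z j + t * (∑ j, c j * z j - ∑ j, c j * x j) := by
    simp only [Finset.mul_sum, ← Finset.sum_add_distrib, ← Finset.sum_sub_distrib, Pi.add_apply,
      Pi.sub_apply, Pi.smul_apply, smul_eq_mul]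
    exact Finset.sum_congr rfl fun j _ => by ring
  have h3 : ∑ j, c j * z j = d := hzF.2
  rw [h2, h3] at h1
  have h4 := hle x hx
  have ht0' : 0 < t := ht0
  nlinarith

lemma IsPolyhedralComplex.disjoint_interior {n : ℕ} {Pc : Finset (Set (Fin n → ℝ))}
    (h : IsPolyhedralComplex Pc) {P Q : Set (Fin n → ℝ)} (hP : P ∈ Pc) (hQ : Q ∈ Pc)
    (hne : P ≠ Q) : Disjoint (interior P) (interior Q) := by
  rw [Set.disjoint_left]
  intro z hzP hzQ
  have hz : z ∈ P ∩ Q := ⟨interior_subset hzP, interior_subset hzQ⟩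
  obtain ⟨h1, h2⟩ := h.2.1 P hP Q hQ
  exact hne ((h1.eq_of_mem_interior hz hzP).symm.trans (h2.eq_of_mem_interior hz hzQ))

/-- Disjoint open convex sets in `ℝ^n` are strictly separated by an affine hyperplane. -/
lemma exists_separating_coefficients {n : ℕ} {U V : Set (Fin n → ℝ)} (hU : IsOpen U)
    (hV : IsOpen V) (hUc : Convex ℝ U) (hVc : Convex ℝ V) (hd : Disjoint U V) :
    ∃ (a : Fin n → ℝ) (b : ℝ), (∀ x ∈ U, ∑ i, a i * x i + b < 0) ∧
      ∀ x ∈ V, 0 < ∑ i, a i * x i + b := by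
  obtain ⟨L, u, h1, h2⟩ := geometric_hahn_banach_open_open hUc hU hVc hV hd
  have hL : ∀ x, L x = ∑ i, L (Pi.single i 1) * x i := by
    intro x
    conv_lhs => rw [pi_eq_sum_univ' x, map_sum]
    refine Finset.sum_congr rfl fun i _ => ?_
    rw [map_smul, smul_eq_mul, mul_comm]
  refine ⟨fun i => L (Pi.single i 1), -u, fun x hx => ?_, fun x hx => ?_⟩
  · have := h1 x hx
    rw [hL] at this
    linarith
  · have := h2 x hx
    rw [hL] at this
    linarith

/-- A sum of weighted affine threshold tests of width `κ` after width `ι`, for arbitrary finite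
index types. -/
lemma ltComputes_two_of_fintype {n : ℕ} {ι κ : Type*} [Fintype ι] [Fintype κ]
    (A : ι → Fin n → ℝ) (b : ι → ℝ) (M : κ → ι → ℝ) (d : κ → ℝ) (v : κ → ℝ) :
    LTComputes n 2 (Fintype.card ι + Fintype.card κ) (fun x =>
      ∑ k, v k * thresh (∑ q, M k q * thresh (∑ i, A q i * x i + b q) + d k)) := by
  let e := Fintype.equivFin ι
  let e' := Fintype.equivFin κ
  refine ⟨_, _, fun k => v (e'.symm k), 0, Hidden.comp
    (fun y k => ∑ q, M (e'.symm k) (e.symm q) * y q + d (e'.symm k))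
    (Hidden.single (w := Fintype.card ι)
      (fun x q => ∑ i, A (e.symm q) i * x i + b (e.symm q)) ⟨_, _, fun _ _ => rfl⟩)
    ⟨_, _, fun _ _ => rfl⟩, fun x => ?_⟩
  dsimp only
  rw [add_zero, ← e'.symm.sum_comp]
  refine Finset.sum_congr rfl fun k _ => ?_
  rw [← e.symm.sum_comp]

/-- Pairwise disjoint open convex sets can be told apart by a threshold network with one neuron
per pair in the first hidden layer and one neuron per set in the second. -/
lemma exists_ltComputes_of_disjoint_convex {n p : ℕ} (U : Fin p → Set (Fin n → ℝ))
    (hU : ∀ k, IsOpen (U k)) (hUc : ∀ k, Convex ℝ (U k))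
    (hd : ∀ i j, i ≠ j → Disjoint (U i) (U j)) (v : Fin p → ℝ) :
    ∃ g, LTComputes n 2 (p * (p - 1) / 2 + p) g ∧ ∀ k, ∀ x ∈ U k, g x = v k := by
  have hlt : ∀ q : (Σ j : Fin p, Fin j), (q.2 : ℕ) < q.1 := fun q => q.2.2
  let lo : (Σ j : Fin p, Fin j) → Fin p := fun q => ⟨q.2, (hlt q).trans q.1.2⟩
  have hlo : ∀ q, lo q ≠ q.1 := fun q h => (hlt q).ne (congrArg Fin.val h)
  have hsep := fun q => exists_separating_coefficients (hU (lo q)) (hU q.1) (hUc _) (hUc _)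
    (hd _ _ (hlo q))
  choose A b hneg hpos using hsep
  have hcard : Fintype.card (Σ j : Fin p, Fin j) = p * (p - 1) / 2 := by
    rw [Fintype.card_sigma]
    simp only [Fintype.card_fin]
    rw [Fin.sum_univ_eq_sum_range (fun i => i) p, Finset.sum_range_id]
  let y : (Σ j : Fin p, Fin j) → (Fin n → ℝ) → ℝ := fun q x => thresh (∑ i, A q i * x i + b q)
  have hy0 : ∀ q, ∀ x ∈ U (lo q), y q x = 0 := fun q x hx => if_neg (hneg q x hx).not_gt
  have hy1 : ∀ q, ∀ x ∈ U q.1, y q x = 1 := fun q x hx => if_pos (hpos q x hx)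
  let M : Fin p → (Σ j : Fin p, Fin j) → ℝ := fun k q =>
    if k = q.1 then 1 else if k = lo q then -1 else 0
  let d : Fin p → ℝ := fun k => 1 / 2 - ∑ q : (Σ j : Fin p, Fin j), if k = q.1 then 1 else 0
  let pen : Fin p → (Σ j : Fin p, Fin j) → (Fin n → ℝ) → ℝ := fun k q x =>
    if k = q.1 then 1 - y q x else if k = lo q then y q x else 0
  have hT : ∀ k x, ∑ q, M k q * y q x + d k = 1 / 2 - ∑ q, pen k q x := by
    intro k x
    have : ∑ q, pen k q x = ∑ q : (Σ j : Fin p, Fin j),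
        ((if k = q.1 then 1 else 0) - M k q * y q x) := by
      refine Finset.sum_congr rfl fun q _ => ?_
      simp only [pen, M]
      split_ifs <;> ring
    rw [this, Finset.sum_sub_distrib]
    simp only [d]
    ring
  have hpen : ∀ k q x, 0 ≤ pen k q x := by
    intro k q x
    obtain ⟨h0, h1⟩ := thresh_mem_Icc (∑ i, A q i * x i + b q)
    simp only [pen, y]
    split_ifs <;> linarith
  have hon : ∀ k, ∀ x ∈ U k, thresh (∑ q, M k q * y q x + d k) = 1 := by
    intro k x hx
    have : ∑ q, pen k q x = 0 := by
      refine Finset.sum_eq_zero fun q _ => ?_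
      simp only [pen]
      split_ifs with h1 h2
      · rw [hy1 q x (h1 ▸ hx), sub_self]
      · exact hy0 q x (h2 ▸ hx)
      · rfl
    rw [hT, this]
    exact if_pos (by norm_num)
  have hoff : ∀ k l, k ≠ l → ∀ x ∈ U l, thresh (∑ q, M k q * y q x + d k) = 0 := by
    intro k l hkl x hx
    obtain ⟨q, hq⟩ : ∃ q, pen k q x = 1 := by
      rcases lt_or_gt_of_ne hkl with h | h
      · refine ⟨⟨l, ⟨k, h⟩⟩, ?_⟩
        simp only [pen]
        rw [if_neg hkl, if_pos rfl]
        exact hy1 _ x hx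
      · refine ⟨⟨k, ⟨l, h⟩⟩, ?_⟩
        simp only [pen]
        rw [if_pos trivial, hy0 _ x hx, sub_zero]
    have hle := Finset.single_le_sum (f := fun q => pen k q x) (fun q _ => hpen k q x)
      (Finset.mem_univ q)
    simp only [hq] at hle
    rw [hT]
    exact if_neg (by linarith)
  refine ⟨fun x => ∑ k, v k * thresh (∑ q, M k q * y q x + d k), ?_, ?_⟩
  · have := ltComputes_two_of_fintype A b M d v
    rwa [hcard, Fintype.card_fin] at this
  · intro k x hx
    dsimp only
    rw [Finset.sum_eq_single k, hon k x hx, mul_one]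
    · intro l _ hl
      rw [hoff l k hl x hx, mul_zero]
    · simp

lemma volume_eq_zero_of_polyDim_ne {n : ℕ} {P : Set (Fin n → ℝ)} (h : polyDim P ≠ n) :
    volume P = 0 := by
  refine measure_mono_null (subset_affineSpan ℝ P) (Measure.addHaar_affineSubspace _ _ ?_)
  intro htop
  apply h
  rw [polyDim, htop, AffineSubspace.direction_top, finrank_top, Module.finrank_fin_fun]

/-- Almost every point lies in the interior of a full-dimensional cell. -/
lemma ae_mem_interior_of_covers {n : ℕ} {Pc : Finset (Set (Fin n → ℝ))}
    (hPc : ∀ P ∈ Pc, IsPolyhedron P) (hcov : Covers Pc) :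
    ∀ᵐ x : Fin n → ℝ, ∃ P ∈ Pc, polyDim P = n ∧ x ∈ interior P := by
  have h : ∀ᵐ x : Fin n → ℝ, ∀ P ∈ Pc, (polyDim P ≠ n → x ∉ P) ∧ x ∉ frontier P := by
    rw [Filter.eventually_all_finset]
    intro P hP
    refine Filter.Eventually.and ?_ ?_
    · by_cases hd : polyDim P = n
      · simp [hd]
      · filter_upwards [measure_eq_zero_iff_ae_notMem.mp (volume_eq_zero_of_polyDim_ne hd)]
          with x hx _ using hx
    · exact measure_eq_zero_iff_ae_notMem.mp ((hPc P hP).convex.addHaar_frontier volume)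
  filter_upwards [h] with x hx
  obtain ⟨P, hP, hxP⟩ : x ∈ ⋃₀ (Pc : Set (Set (Fin n → ℝ))) := by
    rw [show ⋃₀ (Pc : Set (Set (Fin n → ℝ))) = Set.univ from hcov]
    trivial
  have hd : polyDim P = n := by
    by_contra hd
    exact (hx P hP).1 hd hxP
  refine ⟨P, hP, hd, ?_⟩
  by_contra hi
  exact (hx P hP).2 ⟨subset_closure hxP, hi⟩

/-- if `f : ℝ^n → ℝ` is piecewise constant with `p ≥ 2` pieces, then some
linear threshold NN with 2 hidden layers and size at most `p(p+1)/2 + 1` computes a function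
`g` agreeing with `f` Lebesgue-almost everywhere. -/
theorem stmt_6 (n p : ℕ) (hp : 2 ≤ p) (f : (Fin n → ℝ) → ℝ)
    (Pc : Finset (Set (Fin n → ℝ))) (hPc : CompatiblePWC f Pc)
    (hmin : ∀ Qc : Finset (Set (Fin n → ℝ)), CompatiblePWC f Qc → Pc.card ≤ Qc.card)
    (hpieces : {P ∈ (Pc : Set (Set (Fin n → ℝ))) | polyDim P = n}.ncard = p) :
    ∃ (s : ℕ) (g : (Fin n → ℝ) → ℝ), LTComputes n 2 s g ∧
      s ≤ p * (p + 1) / 2 + 1 ∧ volume {x : Fin n → ℝ | g x ≠ f x} = 0 := by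
  obtain ⟨hcx, hcov, hconst⟩ := hPc
  have hfin : {P ∈ (Pc : Set (Set (Fin n → ℝ))) | polyDim P = n}.Finite :=
    Pc.finite_toSet.subset (Set.sep_subset _ _)
  have hcard : Nat.card {P ∈ (Pc : Set (Set (Fin n → ℝ))) | polyDim P = n} = p := hpieces
  have := hfin.to_subtype
  let e := Finite.equivFinOfCardEq hcard
  choose! c hc using hconst
  obtain ⟨g, hg, hgv⟩ := exists_ltComputes_of_disjoint_convex
    (fun k => interior (e.symm k : Set (Fin n → ℝ))) (fun k => isOpen_interior)
    (fun k => (hcx.1 _ (e.symm k).2.1).convex.interior)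
    (fun i j hij => hcx.disjoint_interior (e.symm i).2.1 (e.symm j).2.1
      fun h => hij (e.symm.injective (Subtype.ext h)))
    (fun k => c (e.symm k))
  refine ⟨_, g, hg, ?_, ?_⟩
  · have h : p * (p + 1) = p * (p - 1) + p * 2 := by
      rw [← mul_add]
      congr 1
      omega
    omega
  · have hae : ∀ᵐ x, g x = f x := by
      filter_upwards [ae_mem_interior_of_covers hcx.1 hcov] with x ⟨P, hP, hd, hx⟩
      have hgx := hgv (e ⟨P, hP, hd⟩) x (by simpa using hx)
      rw [hgx, Equiv.symm_apply_apply, hc P hP x (interior_subset_intrinsicInterior hx)]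
    exact ae_iff.mp hae
end
end

section
/- Let P = {x ∈ ℝ^n : ⟨a_i, x⟩ ≤ b_i for i = 1,…,m} be a polyhedron given as the intersection of m closed halfspaces. Then the indicator function 𝟙_P : ℝ^n → ℝ can be computed exactly by a linear threshold neural network with 2 hidden layers and size at most m + 1. -/
open Finset MeasureTheory

noncomputable section

theorem thresh_of_pos {t : ℝ} (h : 0 < t) : thresh t = 1 := if_pos h

theorem thresh_of_nonpos {t : ℝ} (h : t ≤ 0) : thresh t = 0 := if_neg h.not_gt

theorem thresh_nonneg (t : ℝ) : 0 ≤ thresh t := by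
  unfold thresh
  split_ifs <;> norm_num

/-- The conjunction of the conditions `t i ≤ 0` is decided by a single threshold neuron on top
of the neurons `thresh (t i)`. -/
theorem thresh_one_sub_sum_thresh {ι : Type*} [Fintype ι] (t : ι → ℝ) [Decidable (∀ i, t i ≤ 0)] :
    thresh (1 - ∑ i, thresh (t i)) = if ∀ i, t i ≤ 0 then 1 else 0 := by
  split_ifs with h
  · simp [thresh_of_nonpos (h _), thresh_of_pos]
  · push Not at h
    obtain ⟨i, hi⟩ := h
    have hle := Finset.single_le_sum (f := fun i => thresh (t i))
      (fun j _ => thresh_nonneg (t j)) (Finset.mem_univ i)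
    simp only [thresh_of_pos hi] at hle
    exact thresh_of_nonpos (by linarith)

/-- the indicator of a polyhedron described by `m` closed halfspaces is
computed exactly by a linear threshold NN with 2 hidden layers and size at most `m + 1`. -/
theorem stmt_8 (n m : ℕ) (a : Fin m → Fin n → ℝ) (b : Fin m → ℝ) :
    ∃ s : ℕ,
      LTComputes n 2 s
        (Set.indicator {x : Fin n → ℝ | ∀ i, (∑ j, a i j * x j) ≤ b i} (fun _ => (1 : ℝ))) ∧
      s ≤ m + 1 := by
  classical
  refine ⟨m + 1, ⟨1, _, fun _ => 1, 0,
    Hidden.comp (fun y _ => 1 - ∑ i, y i)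
      (Hidden.single (fun x i => (∑ j, a i j * x j) - b i) ⟨a, fun i => -b i, fun x i => by ring⟩)
      ⟨fun _ _ => -1, fun _ => 1, fun y _ => by
        simp only [neg_one_mul, Finset.sum_neg_distrib]
        ring⟩, fun x => ?_⟩, le_rfl⟩
  simp [thresh_one_sub_sum_thresh, Set.indicator_apply]
end
end

section
/- For every n ≥ 1, a function f : ℝ^n → ℝ is piecewise linear if and only if it is computed by a shortcut linear threshold neural network with 2 hidden layers; that is, SLT_n(2) = PWL_n. In particular, the class of continuous piecewise linear functions CPWL_n is strictly contained in SLT_n(2). -/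
open Finset MeasureTheory

noncomputable section

/-- `f : ℝ^n → ℝ` is computed by a shortcut linear threshold neural network with `k` hidden
layers and size `s`: the output is `⟨Aᵀ x + b, x⁽ᵏ⁾⟩` where `x⁽ᵏ⁾` is the output of the
last hidden layer. -/
def SLTComputes (n k s : ℕ) (f : (Fin n → ℝ) → ℝ) : Prop :=
  ∃ (w : ℕ) (g : (Fin n → ℝ) → (Fin w → ℝ)) (A : Fin n → Fin w → ℝ) (b : Fin w → ℝ),
    Hidden n k s w g ∧ ∀ x, f x = ∑ j, ((∑ i, A i j * x i) + b j) * g x j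

/-- `Pc` is a polyhedral complex covering `ℝ^n` with which `f` is compatible as a piecewise
linear function: `f` is affine linear on the relative interior of each member of `Pc`. -/
def CompatiblePWL {n : ℕ} (f : (Fin n → ℝ) → ℝ) (Pc : Finset (Set (Fin n → ℝ))) : Prop :=
  IsPolyhedralComplex Pc ∧ Covers Pc ∧
    ∀ P ∈ Pc, ∃ (a : Fin n → ℝ) (c : ℝ),
      ∀ x ∈ intrinsicInterior ℝ P, f x = (∑ i, a i * x i) + c

/-- `f : ℝ^n → ℝ` is piecewise linear. -/
def IsPWL {n : ℕ} (f : (Fin n → ℝ) → ℝ) : Prop := ∃ Pc, CompatiblePWL f Pc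

section CellwiseAffine

variable {n : ℕ}

lemma exists_coeff_of_affineMap (φ : (Fin n → ℝ) →ᵃ[ℝ] ℝ) :
    ∃ (a : Fin n → ℝ) (b : ℝ), ∀ x, φ x = (∑ i, a i * x i) + b := by
  refine ⟨fun i => φ.linear (Pi.single i 1), φ 0, fun x => ?_⟩
  have h1 : φ x = φ.linear x + φ 0 := by
    have := φ.map_vadd 0 x
    simpa using this
  rw [h1, LinearMap.pi_apply_eq_sum_univ φ.linear x]
  congr 1
  refine Finset.sum_congr rfl fun i _ => ?_
  rw [smul_eq_mul, mul_comm]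
  congr 2
  ext j
  simp [Pi.single_apply, eq_comm]

lemma exists_affineMap_of_coeff (a : Fin n → ℝ) (b : ℝ) :
    ∃ φ : (Fin n → ℝ) →ᵃ[ℝ] ℝ, ∀ x, φ x = (∑ i, a i * x i) + b := by
  refine ⟨(∑ i, a i • LinearMap.proj (R := ℝ) (φ := fun _ : Fin n => ℝ) i).toAffineMap
    + AffineMap.const ℝ _ b, fun x => ?_⟩
  simp

lemma isFace_iff_exists_affineMap {F P : Set (Fin n → ℝ)} :
    IsFace F P ↔ ∃ φ : (Fin n → ℝ) →ᵃ[ℝ] ℝ,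
      (∀ x ∈ P, φ x ≤ 0) ∧ F = {x ∈ P | φ x = 0} := by
  constructor
  · rintro ⟨c, d, h, rfl⟩
    obtain ⟨φ, hφ⟩ := exists_affineMap_of_coeff c (-d)
    refine ⟨φ, fun x hx => ?_, ?_⟩
    · linarith [h x hx, hφ x]
    · ext x
      simp only [Set.mem_ofPred_eq, hφ, add_neg_eq_zero]
  · rintro ⟨φ, h, rfl⟩
    obtain ⟨a, b, hφ⟩ := exists_coeff_of_affineMap φ
    refine ⟨a, -b, fun x hx => ?_, ?_⟩
    · linarith [h x hx, hφ x]
    · ext x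
      simp only [Set.mem_ofPred_eq, hφ, eq_neg_iff_add_eq_zero]

lemma isFace_empty (P : Set (Fin n → ℝ)) : IsFace ∅ P :=
  ⟨0, 1, by simp, by simp⟩

lemma isPolyhedron_of_affineMap {κ : Type} [Fintype κ] (φ : κ → (Fin n → ℝ) →ᵃ[ℝ] ℝ) :
    IsPolyhedron {x | ∀ i, φ i x ≤ 0} := by
  choose a b hab using fun i => exists_coeff_of_affineMap (φ i)
  let e := Fintype.equivFin κ
  refine ⟨Fintype.card κ, fun j => a (e.symm j), fun j => -b (e.symm j), ?_⟩
  ext x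
  simp only [Set.mem_ofPred_eq, hab]
  rw [← e.symm.forall_congr_right]
  refine forall_congr' fun j => ?_
  constructor <;> intro h <;> linarith

lemma IsPolyhedron.exists_affineMap {P : Set (Fin n → ℝ)} (hP : IsPolyhedron P) :
    ∃ (m : ℕ) (φ : Fin m → (Fin n → ℝ) →ᵃ[ℝ] ℝ), P = {x | ∀ i, φ i x ≤ 0} := by
  obtain ⟨m, a, b, rfl⟩ := hP
  choose φ hφ using fun i => exists_affineMap_of_coeff (a i) (-b i)
  refine ⟨m, φ, ?_⟩
  ext x
  simp only [Set.mem_ofPred_eq, hφ, ← sub_eq_add_neg, sub_nonpos]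

/-- `f` agrees with an affine map on each cell of some finite hyperplane arrangement. -/
def IsCellwiseAffine (f : (Fin n → ℝ) → ℝ) : Prop :=
  ∃ (ι : Type) (_ : Fintype ι) (φ : ι → (Fin n → ℝ) →ᵃ[ℝ] ℝ),
    ∀ s : ι → SignType, ∃ ψ : (Fin n → ℝ) →ᵃ[ℝ] ℝ,
      ∀ y, (∀ i, SignType.sign (φ i y) = s i) → f y = ψ y

lemma eventually_lineMap_mem_of_mem_intrinsicInterior {P : Set (Fin n → ℝ)} {x y : Fin n → ℝ}
    (hx : x ∈ intrinsicInterior ℝ P) (hy : y ∈ P) :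
    ∀ᶠ t in nhds (0 : ℝ), AffineMap.lineMap x y t ∈ P := by
  obtain ⟨z, hz, rfl⟩ := mem_intrinsicInterior.1 hx
  let g : ℝ → affineSpan ℝ P := fun t =>
    ⟨AffineMap.lineMap (z : Fin n → ℝ) y t,
      AffineMap.lineMap_mem t z.2 (subset_affineSpan ℝ P hy)⟩
  have hg : Continuous g := by
    refine Continuous.subtype_mk ?_ _
    exact AffineMap.lineMap_continuous
  have hg0 : g 0 = z := Subtype.ext (by simp [g])
  have h := hg.continuousAt (x := 0) |>.eventually
    (p := fun w => w ∈ ((↑) ⁻¹' P : Set (affineSpan ℝ P)))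
    (by rw [hg0]; exact mem_interior_iff_mem_nhds.1 hz)
  exact h

lemma exists_pos_lineMap_neg_mem {P : Set (Fin n → ℝ)} {x y : Fin n → ℝ}
    (h : ∀ᶠ t in nhds (0 : ℝ), AffineMap.lineMap x y t ∈ P) :
    ∃ ε : ℝ, 0 < ε ∧ AffineMap.lineMap x y (-ε) ∈ P := by
  have h' : ∀ᶠ t in nhdsWithin (0 : ℝ) (Set.Iio 0), AffineMap.lineMap x y t ∈ P :=
    h.filter_mono nhdsWithin_le_nhds
  obtain ⟨t, ht, ht0⟩ := (h'.and self_mem_nhdsWithin).exists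
  exact ⟨-t, neg_pos.2 ht0, by simpa using ht⟩

lemma AffineMap.apply_lineMap_real (φ : (Fin n → ℝ) →ᵃ[ℝ] ℝ) (x y : Fin n → ℝ) (t : ℝ) :
    φ (AffineMap.lineMap x y t) = (1 - t) * φ x + t * φ y := by
  rw [AffineMap.apply_lineMap, AffineMap.lineMap_apply_ring]

lemma AffineMap.sum_apply_real {κ : Type} (s : Finset κ) (φ : κ → (Fin n → ℝ) →ᵃ[ℝ] ℝ)
    (x : Fin n → ℝ) : (∑ i ∈ s, φ i) x = ∑ i ∈ s, φ i x := by
  classical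
  induction s using Finset.induction_on with
  | empty => simp
  | insert i s hi ih => simp [Finset.sum_insert hi, ih]

variable {ι : Type} (φ : ι → (Fin n → ℝ) →ᵃ[ℝ] ℝ)

/-- The closed cell with sign vector `s` of the arrangement of the zero sets of `φ`. -/
def closedCell (s : ι → SignType) : Set (Fin n → ℝ) :=
  {x | ∀ i, φ i x = 0 ∨ SignType.sign (φ i x) = s i}

lemma isPolyhedron_closedCell [Fintype ι] (s : ι → SignType) : IsPolyhedron (closedCell φ s) := by
  let k : ι ⊕ ι → ℝ := Sum.elim
    (fun i => -(s i : ℝ) + (1 - (s i : ℝ) ^ 2)) (fun i => -(s i : ℝ) - (1 - (s i : ℝ) ^ 2))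
  have h := isPolyhedron_of_affineMap (fun j : ι ⊕ ι => k j • φ (Sum.elim id id j))
  convert h using 1
  ext x
  simp only [closedCell, Set.mem_ofPred_eq, Sum.forall, ← forall_and]
  refine forall_congr' fun i => ?_
  simp only [AffineMap.coe_smul, Pi.smul_apply, smul_eq_mul, k, Sum.elim_inl, Sum.elim_inr, id]
  rcases s i with _ | _ | _
  · simpa using le_antisymm_iff
  · simp [sign_eq_neg_one_iff, le_iff_lt_or_eq, or_comm]
  · simp [sign_eq_one_iff, le_iff_eq_or_lt]

lemma isFace_closedCell [Fintype ι] {s u : ι → SignType} (h : ∀ i, u i = s i ∨ u i = 0) :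
    IsFace (closedCell φ u) (closedCell φ s) := by
  have key : ∀ x ∈ closedCell φ s, ∀ i, 0 ≤ ((s i : ℝ) - u i) * φ i x := by
    intro x hx i
    rcases h i with h | h
    · simp [h]
    · rcases hx i with hx | hx
      · simp [hx]
      · rw [h, ← hx]
        simp [sign_mul_self]
  refine isFace_iff_exists_affineMap.2 ⟨-∑ i, ((s i : ℝ) - u i) • φ i, ?_, ?_⟩
  · intro x hx
    have := Finset.sum_nonneg (s := Finset.univ) fun i _ => key x hx i
    simpa [AffineMap.sum_apply_real] using this
  · ext x
    simp only [Set.mem_ofPred_eq]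
    have hval : (-∑ i, ((s i : ℝ) - u i) • φ i) x = -∑ i, ((s i : ℝ) - u i) * φ i x := by
      simp [AffineMap.sum_apply_real]
    rw [hval, neg_eq_zero]
    constructor
    · intro hx
      refine ⟨fun i => ?_, Finset.sum_eq_zero fun i _ => ?_⟩
      · rcases hx i with hx | hx
        · exact Or.inl hx
        · rcases h i with h | h
          · exact Or.inr (hx.trans h)
          · exact Or.inl (sign_eq_zero_iff.1 (hx.trans h))
      · rcases h i with h | h
        · simp [h]
        · rcases hx i with hx | hx
          · simp [hx]
          · simp [sign_eq_zero_iff.1 (hx.trans h)]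
    · rintro ⟨hx, h0⟩ i
      have h1 := (Finset.sum_eq_zero_iff_of_nonneg fun i _ => key x hx i).1 h0 i
        (Finset.mem_univ i)
      rcases hx i with hxi | hxi
      · exact Or.inl hxi
      · rcases h i with h | h
        · exact Or.inr (hxi.trans h.symm)
        · left
          rw [h, ← hxi] at h1
          simpa [sign_mul_self] using h1

lemma closedCell_inter (s t : ι → SignType) :
    closedCell φ s ∩ closedCell φ t = closedCell φ fun i => if s i = t i then s i else 0 := by
  ext x
  simp only [closedCell, Set.mem_inter_iff, Set.mem_ofPred_eq, ← forall_and]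
  refine forall_congr' fun i => ?_
  split_ifs with h
  · simp [h]
  · rw [sign_eq_zero_iff, or_self]
    constructor
    · rintro ⟨h1 | h1, h2 | h2⟩
      · exact h1
      · exact h1
      · exact h2
      · exact absurd (h1.symm.trans h2) h
    · exact fun h => ⟨Or.inl h, Or.inl h⟩

variable {φ}

lemma eq_zero_of_mem_intrinsicInterior {s : ι → SignType} {F : Set (Fin n → ℝ)}
    (hF : F ⊆ closedCell φ s) {x y : Fin n → ℝ} (hx : x ∈ intrinsicInterior ℝ F) (hy : y ∈ F)
    {i : ι} (h0 : φ i x = 0) : φ i y = 0 := by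
  obtain ⟨ε, hε, hmem⟩ := exists_pos_lineMap_neg_mem
    (eventually_lineMap_mem_of_mem_intrinsicInterior hx hy)
  have h1 := hF hmem i
  have h2 := hF hy i
  rw [AffineMap.apply_lineMap_real, h0] at h1
  by_contra hne
  have h2 := h2.resolve_left hne
  have h3 := h1.resolve_left (by simp [hε.ne', hne])
  rw [← h2] at h3
  rcases lt_or_gt_of_ne hne with h | h
  · rw [sign_neg h, sign_eq_neg_one_iff] at h3
    nlinarith
  · rw [sign_pos h, sign_eq_one_iff] at h3
    nlinarith

lemma exists_eq_closedCell_of_isFace [Fintype ι] {s : ι → SignType} {F : Set (Fin n → ℝ)}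
    (hF : IsFace F (closedCell φ s)) (hne : F.Nonempty) : ∃ u, F = closedCell φ u := by
  obtain ⟨m, ξ, hξ⟩ := (isPolyhedron_closedCell φ s).exists_affineMap
  obtain ⟨ψ, hψ, hFeq⟩ := isFace_iff_exists_affineMap.1 hF
  have hsub : F ⊆ closedCell φ s := by
    rw [hFeq]
    exact Set.sep_subset _ _
  have hconv : Convex ℝ F := by
    rw [hFeq, hξ]
    refine Convex.inter (s := {x | ∀ i, ξ i x ≤ 0}) (t := {x | ψ x = 0}) ?_ ?_
    · rw [Set.ofPred_forall]
      exact convex_iInter fun i => (convex_Iic (0 : ℝ)).affine_preimage (ξ i)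
    · exact (convex_singleton (0 : ℝ)).affine_preimage ψ
  obtain ⟨x, hx⟩ := hne.intrinsicInterior hconv
  have hxF : x ∈ F := intrinsicInterior_subset hx
  refine ⟨fun i => SignType.sign (φ i x), Set.Subset.antisymm ?_ ?_⟩
  · intro y hy i
    by_cases h0 : φ i x = 0
    · exact Or.inl (eq_zero_of_mem_intrinsicInterior hsub hx hy h0)
    · dsimp only
      rw [(hsub hxF i).resolve_left h0]
      exact hsub hy i
  · intro y hy
    have hcell : ∀ᶠ t in nhds (0 : ℝ), AffineMap.lineMap x y t ∈ closedCell φ s := by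
      refine Filter.eventually_all.2 fun i => ?_
      by_cases h0 : φ i x = 0
      · have hy0 : φ i y = 0 := by
          rcases hy i with h | h
          · exact h
          · simpa [h0] using h
        refine Filter.Eventually.of_forall fun t => Or.inl ?_
        rw [AffineMap.apply_lineMap_real, h0, hy0]
        ring
      · have hs := (hsub hxF i).resolve_left h0
        have hc : ContinuousAt (fun t : ℝ => (1 - t) * φ i x + t * φ i y) 0 := by fun_prop
        have hev : ∀ᶠ t in nhds (0 : ℝ),
            SignType.sign ((1 - t) * φ i x + t * φ i y) = SignType.sign (φ i x) := by
          rcases lt_or_gt_of_ne h0 with h | h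
          · filter_upwards [hc.eventually_lt continuousAt_const (by simpa using h)] with t ht
            rw [sign_neg h, sign_neg ht]
          · filter_upwards [continuousAt_const.eventually_lt hc (by simpa using h)] with t ht
            rw [sign_pos h, sign_pos ht]
        filter_upwards [hev] with t ht
        right
        rw [AffineMap.apply_lineMap_real, ht, hs]
    have hys : y ∈ closedCell φ s := by
      intro i
      rcases hy i with h | h
      · exact Or.inl h
      · rcases hsub hxF i with h' | h'
        · left
          simpa [h'] using h
        · exact Or.inr (h.trans h')
    obtain ⟨ε, hε, hmem⟩ := exists_pos_lineMap_neg_mem hcell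
    have h1 := hψ _ hmem
    have hx0 : ψ x = 0 := by
      rw [hFeq] at hxF
      exact hxF.2
    rw [AffineMap.apply_lineMap_real, hx0] at h1
    rw [hFeq]
    refine ⟨hys, le_antisymm (hψ y hys) ?_⟩
    by_contra hlt
    nlinarith

lemma IsCellwiseAffine.isPWL {f : (Fin n → ℝ) → ℝ} (hf : IsCellwiseAffine f) : IsPWL f := by
  classical
  obtain ⟨ι, _, φ, hφ⟩ := hf
  have hmem : ∀ P, P ∈ insert ∅ (Finset.univ.image (closedCell φ)) ↔
      P = ∅ ∨ ∃ s, closedCell φ s = P := by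
    intro P
    simp
  refine ⟨insert ∅ (Finset.univ.image (closedCell φ)), ⟨?_, ?_, ?_⟩, ?_, ?_⟩
  · intro P hP
    rcases (hmem P).1 hP with rfl | ⟨s, rfl⟩
    · exact ⟨1, fun _ => 0, fun _ => -1, by ext; norm_num⟩
    · exact isPolyhedron_closedCell φ s
  · intro P hP Q hQ
    rcases (hmem P).1 hP with rfl | ⟨s, rfl⟩
    · rw [Set.empty_inter]
      exact ⟨isFace_empty _, isFace_empty _⟩
    rcases (hmem Q).1 hQ with rfl | ⟨t, rfl⟩
    · rw [Set.inter_empty]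
      exact ⟨isFace_empty _, isFace_empty _⟩
    rw [closedCell_inter]
    refine ⟨isFace_closedCell φ fun i => ?_, isFace_closedCell φ fun i => ?_⟩
    · split_ifs <;> simp
    · split_ifs with h <;> simp [h]
  · intro P hP F hF
    rw [hmem]
    rcases F.eq_empty_or_nonempty with h | hne
    · exact Or.inl h
    right
    rcases (hmem P).1 hP with rfl | ⟨s, rfl⟩
    · obtain ⟨c, d, -, rfl⟩ := hF
      simp at hne
    · obtain ⟨u, rfl⟩ := exists_eq_closedCell_of_isFace hF hne
      exact ⟨u, rfl⟩
  · refine Set.eq_univ_of_forall fun x => ?_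
    exact ⟨closedCell φ fun i => SignType.sign (φ i x),
      (hmem _).2 (Or.inr ⟨_, rfl⟩), fun i => Or.inr rfl⟩
  · intro P hP
    rcases (intrinsicInterior ℝ P).eq_empty_or_nonempty with h | ⟨x, hx⟩
    · exact ⟨0, 0, by simp [h]⟩
    have hxP := intrinsicInterior_subset hx
    rcases (hmem P).1 hP with rfl | ⟨s, rfl⟩
    · simp at hxP
    obtain ⟨ψ, hψ⟩ := hφ fun i => SignType.sign (φ i x)
    obtain ⟨a, c, hac⟩ := exists_coeff_of_affineMap ψ
    refine ⟨a, c, fun y hy => ?_⟩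
    rw [← hac]
    have hyP := intrinsicInterior_subset hy
    refine hψ y fun i => ?_
    by_cases h0 : φ i x = 0
    · rw [h0, eq_zero_of_mem_intrinsicInterior subset_rfl hx hyP h0]
    · have hy0 : φ i y ≠ 0 :=
        fun h => h0 (eq_zero_of_mem_intrinsicInterior subset_rfl hy hxP h)
      exact ((hyP i).resolve_left hy0).trans ((hxP i).resolve_left h0).symm

lemma isFace_tight [Fintype ι] (φ : ι → (Fin n → ℝ) →ᵃ[ℝ] ℝ) (x : Fin n → ℝ) :
    IsFace {z | (∀ i, φ i z ≤ 0) ∧ ∀ i, φ i x = 0 → φ i z = 0} {z | ∀ i, φ i z ≤ 0} := by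
  classical
  refine isFace_iff_exists_affineMap.2
    ⟨∑ i with φ i x = 0, φ i, fun z hz => ?_, ?_⟩
  · rw [AffineMap.sum_apply_real]
    exact Finset.sum_nonpos fun i (_ : i ∈ Finset.univ.filter fun i => φ i x = 0) => hz i
  · ext z
    simp only [Set.mem_ofPred_eq]
    refine and_congr_right fun hz => ?_
    have hval : (∑ i with φ i x = 0, φ i) z = ∑ i with φ i x = 0, φ i z :=
      AffineMap.sum_apply_real _ _ _
    rw [hval, Finset.sum_eq_zero_iff_of_nonpos fun i _ => hz i]
    simp

lemma mem_intrinsicInterior_tight [Fintype ι] {φ : ι → (Fin n → ℝ) →ᵃ[ℝ] ℝ} {x y : Fin n → ℝ}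
    (hy : ∀ i, φ i y ≤ 0) (hxy : ∀ i, φ i y = 0 ↔ φ i x = 0) :
    y ∈ intrinsicInterior ℝ {z | (∀ i, φ i z ≤ 0) ∧ ∀ i, φ i x = 0 → φ i z = 0} := by
  set F := {z | (∀ i, φ i z ≤ 0) ∧ ∀ i, φ i x = 0 → φ i z = 0} with hF
  have hyF : y ∈ F := ⟨hy, fun i => (hxy i).2⟩
  have hspan : ∀ z ∈ affineSpan ℝ F, ∀ i, φ i x = 0 → φ i z = 0 := by
    intro z hz i hi
    have hle : affineSpan ℝ F ≤ (affineSpan ℝ {(0 : ℝ)}).comap (φ i) := by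
      refine affineSpan_le.2 fun w hw => ?_
      simpa using hw.2 i hi
    simpa using hle hz
  refine mem_intrinsicInterior.2 ⟨⟨y, subset_affineSpan ℝ F hyF⟩, ?_, rfl⟩
  have hopen : IsOpen {z : Fin n → ℝ | ∀ i, φ i x ≠ 0 → φ i z < 0} := by
    simp only [Set.ofPred_forall]
    exact isOpen_iInter_of_finite fun i => isOpen_iInter_of_finite fun _ =>
      isOpen_Iio.preimage (φ i).continuous_of_finiteDimensional
  refine mem_interior.2 ⟨_, ?_, hopen.preimage continuous_subtype_val, ?_⟩
  · intro z hz
    refine ⟨fun i => ?_, hspan z z.2⟩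
    by_cases hi : φ i x = 0
    · exact (hspan z z.2 i hi).le
    · exact (hz i hi).le
  · exact fun i hi => lt_of_le_of_ne (hy i) fun h => hi ((hxy i).1 h)

lemma IsPWL.isCellwiseAffine {f : (Fin n → ℝ) → ℝ} (hf : IsPWL f) : IsCellwiseAffine f := by
  obtain ⟨Pc, ⟨hpoly, -, hface⟩, hcov, haff⟩ := hf
  choose m φ hφ using fun P : Pc => (hpoly P.1 P.2).exists_affineMap
  refine ⟨Σ P : Pc, Fin (m P), inferInstance, fun j => φ j.1 j.2, fun s => ?_⟩
  by_cases hs : ∃ x, ∀ j : Σ P : Pc, Fin (m P), SignType.sign (φ j.1 j.2 x) = s j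
  swap
  · exact ⟨0, fun y hy => absurd ⟨y, hy⟩ hs⟩
  obtain ⟨x, hx⟩ := hs
  obtain ⟨P, hP, hxP⟩ : x ∈ ⋃₀ (Pc : Set (Set (Fin n → ℝ))) := by
    rw [hcov]
    trivial
  have hP' : P ∈ Pc := by simpa using hP
  let p : Pc := ⟨P, hP'⟩
  have hPeq : P = {z | ∀ i, φ p i z ≤ 0} := hφ p
  have hF := hface P hP' _ (by rw [hPeq]; exact isFace_tight (φ p) x)
  obtain ⟨a, c, hac⟩ := haff _ hF
  obtain ⟨ψ, hψ⟩ := exists_affineMap_of_coeff a c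
  refine ⟨ψ, fun y hy => ?_⟩
  rw [hψ]
  have hsign : ∀ i, SignType.sign (φ p i y) = SignType.sign (φ p i x) :=
    fun i => (hy ⟨p, i⟩).trans (hx ⟨p, i⟩).symm
  rw [hPeq] at hxP
  refine hac y (mem_intrinsicInterior_tight (fun i => ?_) fun i => ?_)
  · rw [← sign_nonpos_iff, hsign, sign_nonpos_iff]
    exact hxP i
  · rw [← sign_eq_zero_iff, hsign, sign_eq_zero_iff]

lemma thresh_eq_of_sign_eq {s t : ℝ} (h : SignType.sign s = SignType.sign t) :
    thresh s = thresh t := by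
  have : 0 < s ↔ 0 < t := by
    rw [← sign_eq_one_iff, h, sign_eq_one_iff]
  simp [thresh, this]

lemma Hidden.exists_affineMap {k s w : ℕ} {g : (Fin n → ℝ) → Fin w → ℝ}
    (hg : Hidden n k s w g) :
    ∃ (m : ℕ) (φ : Fin m → (Fin n → ℝ) →ᵃ[ℝ] ℝ),
      ∀ x y, (∀ j, SignType.sign (φ j x) = SignType.sign (φ j y)) → g x = g y := by
  induction hg with
  | @single w T hT =>
    obtain ⟨M, c, hT⟩ := hT
    choose φ hφ using fun j => exists_affineMap_of_coeff (M j) (c j)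
    refine ⟨w, φ, fun x y h => funext fun j => thresh_eq_of_sign_eq ?_⟩
    rw [hT, hT, ← hφ, ← hφ]
    exact h j
  | comp T _ _ ih =>
    obtain ⟨m, φ, h⟩ := ih
    refine ⟨m, φ, fun x y hxy => ?_⟩
    dsimp only
    rw [h x y hxy]

lemma SLTComputes.isCellwiseAffine {k s : ℕ} {f : (Fin n → ℝ) → ℝ}
    (hf : SLTComputes n k s f) : IsCellwiseAffine f := by
  obtain ⟨w, g, A, b, hg, hf⟩ := hf
  obtain ⟨m, φ, hφ⟩ := hg.exists_affineMap
  choose ψ hψ using fun j => exists_affineMap_of_coeff (fun i => A i j) (b j)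
  refine ⟨Fin m, inferInstance, φ, fun s => ?_⟩
  by_cases hs : ∃ x, ∀ j, SignType.sign (φ j x) = s j
  swap
  · exact ⟨0, fun y hy => absurd ⟨y, hy⟩ hs⟩
  obtain ⟨x, hx⟩ := hs
  refine ⟨∑ j, g x j • ψ j, fun y hy => ?_⟩
  rw [hf, hφ y x fun j => (hy j).trans (hx j).symm]
  simp [AffineMap.sum_apply_real, hψ, mul_comm]

lemma sign_eq_thresh_sub_thresh (t : ℝ) :
    ((SignType.sign t : SignType) : ℝ) = thresh t - thresh (-t) := by
  rcases lt_trichotomy t 0 with h | h | h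
  · simp [thresh, h, not_lt.2 h.le]
  · simp [thresh, h]
  · simp [thresh, h, not_lt.2 h.le]

lemma sign_sq_eq_thresh_add_thresh (t : ℝ) :
    ((SignType.sign t : SignType) : ℝ) ^ 2 = thresh t + thresh (-t) := by
  rcases lt_trichotomy t 0 with h | h | h
  · simp [thresh, h, not_lt.2 h.le]
  · simp [thresh, h]
  · simp [thresh, h, not_lt.2 h.le]

lemma one_le_sq_sub_of_signType_ne {σ τ : SignType} (h : σ ≠ τ) :
    1 ≤ ((σ : ℝ) - τ) ^ 2 := by
  rcases σ with _ | _ | _ <;> rcases τ with _ | _ | _ <;>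
    first | exact absurd rfl h | norm_num

open Classical in
lemma thresh_one_sub_sum_sq [Fintype ι] (σ τ : ι → SignType) :
    thresh (1 - ∑ i, ((σ i : ℝ) - τ i) ^ 2) = if σ = τ then 1 else 0 := by
  split_ifs with h
  · simp [h, thresh]
  · obtain ⟨i, hi⟩ := Function.ne_iff.1 h
    have h1 := one_le_sq_sub_of_signType_ne hi
    have h2 := Finset.single_le_sum (f := fun i => ((σ i : ℝ) - τ i) ^ 2)
      (fun i _ => sq_nonneg _) (Finset.mem_univ i)
    rw [thresh, if_neg]
    linarith

lemma IsCellwiseAffine.exists_sltComputes {f : (Fin n → ℝ) → ℝ} (hf : IsCellwiseAffine f) :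
    ∃ s, SLTComputes n 2 s f := by
  classical
  obtain ⟨ι, _, φ, hφ⟩ := hf
  choose ψ hψ using hφ
  choose a b hab using fun s => exists_coeff_of_affineMap (ψ s)
  choose p q hpq using fun i => exists_coeff_of_affineMap (φ i)
  let e := Fintype.equivFin (ι ⊕ ι)
  let e' := Fintype.equivFin (ι → SignType)
  let T₁ : (Fin n → ℝ) → Fin (Fintype.card (ι ⊕ ι)) → ℝ := fun x j =>
    Sum.elim (fun i => φ i x) (fun i => -φ i x) (e.symm j)
  let M : (ι → SignType) → ι ⊕ ι → ℝ := fun s =>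
    Sum.elim (fun i => 2 * (s i : ℝ) - 1) (fun i => -2 * (s i : ℝ) - 1)
  let T₂ : (Fin (Fintype.card (ι ⊕ ι)) → ℝ) → Fin (Fintype.card (ι → SignType)) → ℝ :=
    fun z j => (∑ k, M (e'.symm j) (e.symm k) * z k) + (1 - ∑ i, (e'.symm j i : ℝ) ^ 2)
  have hT₁ : IsAffineMap T₁ := by
    refine ⟨fun j => Sum.elim p (fun i => -p i) (e.symm j),
      fun j => Sum.elim q (fun i => -q i) (e.symm j), fun x j => ?_⟩
    rcases h : e.symm j with i | i
    · simp [T₁, h, hpq]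
    · simp [T₁, h, hpq]
      ring
  have hT₂ : IsAffineMap T₂ := ⟨_, _, fun _ _ => rfl⟩
  refine ⟨_, _, _, fun i j => a (e'.symm j) i, fun j => b (e'.symm j),
    Hidden.comp T₂ (Hidden.single T₁ hT₁) hT₂, fun x => ?_⟩
  have hcell : ∀ j, thresh (T₂ (fun k => thresh (T₁ x k)) j) =
      if (fun i => SignType.sign (φ i x)) = e'.symm j then 1 else 0 := by
    intro j
    rw [← thresh_one_sub_sum_sq]
    congr 1
    have hsum : ∑ k, M (e'.symm j) (e.symm k) * thresh (T₁ x k) =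
        ∑ k : ι ⊕ ι, M (e'.symm j) k *
          thresh (Sum.elim (fun i => φ i x) (fun i => -φ i x) k) :=
      e.symm.sum_comp fun k => M (e'.symm j) k *
          thresh (Sum.elim (fun i => φ i x) (fun i => -φ i x) k)
    simp only [T₂]
    rw [hsum, Fintype.sum_sum_type]
    simp only [M, Sum.elim_inl, Sum.elim_inr]
    rw [add_sub_left_comm, sub_eq_add_neg]
    congr 1
    rw [← Finset.sum_add_distrib, ← Finset.sum_neg_distrib, ← Finset.sum_neg_distrib,
      ← Finset.sum_add_distrib]
    refine Finset.sum_congr rfl fun i _ => ?_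
    have h1 := sign_eq_thresh_sub_thresh (φ i x)
    have h2 := sign_sq_eq_thresh_add_thresh (φ i x)
    linear_combination h2 - 2 * (e'.symm j i : ℝ) * h1
  simp only [hcell]
  rw [Finset.sum_eq_single (e' fun i => SignType.sign (φ i x))]
  · rw [Equiv.symm_apply_apply, if_pos rfl, mul_one, ← hab]
    exact hψ _ x fun i => rfl
  · intro j _ hj
    rw [if_neg, mul_zero]
    rintro h
    exact hj (by rw [h, Equiv.apply_symm_apply])
  · intro h
    exact absurd (Finset.mem_univ _) h

lemma isCellwiseAffine_thresh (φ : (Fin n → ℝ) →ᵃ[ℝ] ℝ) :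
    IsCellwiseAffine fun x => thresh (φ x) := by
  refine ⟨Unit, inferInstance, fun _ => φ, fun s => ?_⟩
  refine ⟨AffineMap.const ℝ _ (thresh (s () : ℝ)), fun y hy => ?_⟩
  rw [AffineMap.const_apply, ← hy ()]
  refine thresh_eq_of_sign_eq ?_
  rcases lt_trichotomy (φ y) 0 with h | h | h <;> simp [h]

lemma not_continuous_thresh : ¬ Continuous thresh := by
  intro h
  have h1 : thresh ⁻¹' {1} = Set.Ioi 0 := by
    ext t
    simp [thresh]
  have h2 : IsClosed (Set.Ioi (0 : ℝ)) := h1 ▸ isClosed_singleton.preimage h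
  have h3 := h2.closure_eq
  rw [closure_Ioi] at h3
  have h4 : (0 : ℝ) ∈ Set.Ioi (0 : ℝ) := h3 ▸ Set.self_mem_Ici
  exact lt_irrefl (0 : ℝ) h4

end CellwiseAffine

/-- for `n ≥ 1`, `SLT_n(2) = PWL_n`, and the continuous piecewise linear
functions are strictly contained in `SLT_n(2)`. -/
theorem stmt_16 (n : ℕ) (hn : 1 ≤ n) :
    (∀ f : (Fin n → ℝ) → ℝ, (∃ s : ℕ, SLTComputes n 2 s f) ↔ IsPWL f) ∧
    (∀ f : (Fin n → ℝ) → ℝ, IsPWL f ∧ Continuous f → ∃ s : ℕ, SLTComputes n 2 s f) ∧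
    (∃ f : (Fin n → ℝ) → ℝ, (∃ s : ℕ, SLTComputes n 2 s f) ∧
      ¬ (IsPWL f ∧ Continuous f)) := by
  refine ⟨fun f => ⟨?_, fun hf => hf.isCellwiseAffine.exists_sltComputes⟩,
    fun f hf => hf.1.isCellwiseAffine.exists_sltComputes, ?_⟩
  · rintro ⟨s, hf⟩
    exact hf.isCellwiseAffine.isPWL
  · let φ := (LinearMap.proj (R := ℝ) (φ := fun _ : Fin n => ℝ) ⟨0, hn⟩).toAffineMap
    refine ⟨fun x => thresh (φ x), (isCellwiseAffine_thresh φ).exists_sltComputes, ?_⟩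
    rintro ⟨-, h⟩
    refine not_continuous_thresh ?_
    exact h.comp (continuous_pi fun _ => continuous_id : Continuous fun (t : ℝ) (_ : Fin n) => t)
end
end
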